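/- The multiset consisting of the elements ν_7^j and ν_7^j ν_3 for j = 0, 1, …, 5, together with the elements ν_7^6 ν_3^2 ν_5^k for k = 1, 2, 3, 4, is a minimal vanishing sorou of weight 16, all 16 of whose elements are roots of unity of odd order. -/

import Mathlib

open Complex

noncomputable def nu (n : ℕ) : ℂ := Complex.exp (2 * Real.pi * Complex.I / n)

def IsRootOfUnity (z : ℂ) : Prop := ∃ n : ℕ, 0 < n ∧ z ^ n = 1

def IsSorou (h : Multiset ℂ) : Prop := h ≠ 0 ∧ ∀ z ∈ h, IsRootOfUnity z

noncomputable def rootOrder (z : ℂ) : ℕ := sInf {d : ℕ | 0 < d ∧ z ^ d = 1}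

noncomputable def sorouOrder (h : Multiset ℂ) : ℕ := (h.map rootOrder).lcm

noncomputable def relOrder (h : Multiset ℂ) : ℕ :=
  (h.bind fun a => h.map fun b => rootOrder (a / b)).lcm

def IsMinVanishing (h : Multiset ℂ) : Prop :=
  h.sum = 0 ∧ ∀ g : Multiset ℂ, g ≤ h → g ≠ 0 → g ≠ h → g.sum ≠ 0

noncomputable def stmt17Sorou : Multiset ℂ :=
  ((Multiset.range 6).bind fun j => ({nu 7 ^ j, nu 7 ^ j * nu 3} : Multiset ℂ)) +
  ((Multiset.range 4).map fun k => nu 7 ^ 6 * nu 3 ^ 2 * nu 5 ^ (k + 1))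

open Polynomial in
/-- Algebraic conjugation: a relation between a primitive `p`-th root of unity `z` and elements of
`ℚ[w]`, where `w` has order coprime to `p`, persists when `z` is replaced by another primitive
`p`-th root of unity. -/
theorem IsPrimitiveRoot.sum_mul_pow_eq_zero_of_coprime {K : Type*} [Field K] [CharZero K]
    {p m : ℕ} (hp : 0 < p) (hm : 0 < m) (hpm : p.Coprime m) {z z' w : K}
    (hz : IsPrimitiveRoot z p) (hz' : IsPrimitiveRoot z' p) (hw : IsPrimitiveRoot w m)
    {s : Finset ℕ} {x : ℕ → K} (hx : ∀ i ∈ s, x i ∈ Algebra.adjoin ℚ {w})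
    (h : ∑ i ∈ s, x i * z ^ i = 0) : ∑ i ∈ s, x i * z' ^ i = 0 := by
  have hroot (y : K) (hy : IsPrimitiveRoot y p) : IsPrimitiveRoot (y * w) (p * m) := by
    rw [IsPrimitiveRoot.iff_orderOf, (Commute.all y w).orderOf_mul_eq_mul_orderOf_of_coprime,
      ← hy.eq_orderOf, ← hw.eq_orderOf]
    rwa [← hy.eq_orderOf, ← hw.eq_orderOf]
  obtain ⟨e, hep, hem⟩ := Nat.chineseRemainder hpm 1 0
  obtain ⟨f, hfp, hfm⟩ := Nat.chineseRemainder hpm 0 1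
  have hpow {y : K} {n a b : ℕ} (hy : IsPrimitiveRoot y n) (hab : a ≡ b [MOD n]) :
      y ^ a = y ^ b := pow_eq_pow_of_modEq hab hy.pow_eq_one
  have he (y : K) (hy : IsPrimitiveRoot y p) : (y * w) ^ e = y := by
    rw [mul_pow, hpow hy hep, hpow hw hem, pow_one, pow_zero, mul_one]
  have hf (y : K) (hy : IsPrimitiveRoot y p) : (y * w) ^ f = w := by
    rw [mul_pow, hpow hy hfp, hpow hw hfm, pow_one, pow_zero, one_mul]
  have hA (i : ℕ) : ∃ A : ℚ[X], i ∈ s → aeval w A = x i := by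
    by_cases hi : i ∈ s
    · have := hx i hi
      rw [Algebra.adjoin_singleton_eq_range_aeval] at this
      obtain ⟨A, hA⟩ := this
      exact ⟨A, fun _ => hA⟩
    · exact ⟨0, fun h => absurd h hi⟩
  choose A hA using hA
  let P : ℚ[X] := ∑ i ∈ s, (A i).comp (X ^ f) * (X ^ e) ^ i
  have hP (y : K) (hy : IsPrimitiveRoot y p) : aeval (y * w) P = ∑ i ∈ s, x i * y ^ i := by
    simp only [P, map_sum, map_mul, map_pow, aeval_comp, aeval_X, he y hy, hf y hy]
    exact Finset.sum_congr rfl fun i hi => by rw [hA i hi]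
  rw [← hP z' hz', ← minpoly.dvd_iff, ← cyclotomic_eq_minpoly_rat (hroot z' hz') (by positivity),
    cyclotomic_eq_minpoly_rat (hroot z hz) (by positivity), minpoly.dvd_iff, hP z hz, h]

open Polynomial in
/-- If `z` is a primitive root of unity of prime order `p` and `w` one of order coprime to `p`, then
up to scaling `1 + z + ⋯ + z ^ (p - 1) = 0` is the only relation of degree less than `p` for `z`
over `ℚ[w]`. -/
theorem IsPrimitiveRoot.eq_of_sum_mul_pow_eq_zero {K : Type*} [Field K] [CharZero K]
    {p m : ℕ} (hp : p.Prime) (hm : 0 < m) (hpm : p.Coprime m) {z w : K}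
    (hz : IsPrimitiveRoot z p) (hw : IsPrimitiveRoot w m)
    {x : ℕ → K} (hx : ∀ i < p, x i ∈ Algebra.adjoin ℚ {w})
    (h : ∑ i ∈ Finset.range p, x i * z ^ i = 0) {i j : ℕ} (hi : i < p) (hj : j < p) :
    x i = x j := by
  obtain ⟨q, rfl⟩ : ∃ q, p = q + 1 := ⟨p - 1, (Nat.succ_pred_prime hp).symm⟩
  suffices H : ∀ i < q + 1, x i = x q by rw [H i hi, H j hj]
  let F : K[X] := ∑ i ∈ Finset.range q, C (x i - x q) * X ^ i
  have hF : F = 0 := by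
    refine eq_zero_of_degree_lt_of_eval_finset_eq_zero (primitiveRoots (q + 1) K) ?_ fun y hy => ?_
    · rw [hz.card_primitiveRoots, Nat.totient_prime hp, Nat.add_sub_cancel]
      refine (degree_sum_le _ _).trans_lt ((Finset.sup_lt_iff (WithBot.bot_lt_coe q)).2 ?_)
      intro i hi
      exact (degree_C_mul_X_pow_le i _).trans_lt (WithBot.coe_lt_coe.2 (Finset.mem_range.1 hi))
    · have hy' := isPrimitiveRoot_of_mem_primitiveRoots hy
      have h0 := hz.sum_mul_pow_eq_zero_of_coprime hp.pos hm hpm hy' hw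
        (fun i hi => hx i (Finset.mem_range.1 hi)) h
      have h1 := hy'.geom_sum_eq_zero hp.one_lt
      rw [Finset.sum_range_succ] at h0 h1
      simp only [F, eval_finsetSum, eval_mul, eval_C, eval_pow, eval_X, sub_mul,
        Finset.sum_sub_distrib, ← Finset.mul_sum]
      linear_combination h0 - x q * h1
  intro i hi
  rcases Nat.lt_succ_iff_lt_or_eq.1 hi with hi | rfl
  · have hc := congrArg (coeff · i) hF
    simpa [F, hi, sub_eq_zero, finsetSum_coeff, coeff_C_mul_X_pow, -map_sub, -coeff_C_mul] using hc
  · rfl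

theorem Multiset.exists_le_of_le_map {α β : Type*} {f : α → β} {s : Multiset α} {g : Multiset β}
    (h : g ≤ s.map f) : ∃ t ≤ s, g = t.map f := by
  induction s, g using Quotient.inductionOn₂ with
  | _ s g =>
    obtain ⟨l, hl, hs⟩ := h
    obtain ⟨t, ht, rfl⟩ := List.sublist_map_iff.1 hs
    exact ⟨t, ht.subperm, Quotient.sound hl.symm⟩

theorem rootOrder_eq_orderOf {z : ℂ} (hz : IsRootOfUnity z) : rootOrder z = orderOf z := by
  have hmem := Nat.sInf_mem (s := {d : ℕ | 0 < d ∧ z ^ d = 1}) hz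
  exact le_antisymm
    (Nat.sInf_le ⟨(isOfFinOrder_iff_pow_eq_one.2 hz).orderOf_pos, pow_orderOf_eq_one z⟩)
    (orderOf_le_of_pow_eq_one hmem.1 hmem.2)

theorem nu_isPrimitiveRoot {n : ℕ} (hn : n ≠ 0) : IsPrimitiveRoot (nu n) n :=
  Complex.isPrimitiveRoot_exp n hn

/-- An indexing of the elements of `stmt17Sorou`. -/
noncomputable def stmt17Element : Fin 6 × Fin 2 ⊕ Fin 4 → ℂ :=
  Sum.elim (fun j => nu 7 ^ (j.1 : ℕ) * nu 3 ^ (j.2 : ℕ))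
    fun k => nu 7 ^ 6 * nu 3 ^ 2 * nu 5 ^ (k + 1 : ℕ)

theorem stmt17Sorou_eq_map : stmt17Sorou = Finset.univ.val.map stmt17Element := by
  have h6 : Multiset.range 6 = {0, 1, 2, 3, 4, 5} := rfl
  have h4 : Multiset.range 4 = {0, 1, 2, 3} := rfl
  have hu : (Finset.univ : Finset (Fin 6 × Fin 2 ⊕ Fin 4)).val =
    {.inl (0, 0), .inl (0, 1), .inl (1, 0), .inl (1, 1), .inl (2, 0), .inl (2, 1),
      .inl (3, 0), .inl (3, 1), .inl (4, 0), .inl (4, 1), .inl (5, 0), .inl (5, 1),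
      .inr 0, .inr 1, .inr 2, .inr 3} := rfl
  rw [stmt17Sorou, h6, h4, hu]
  simp [stmt17Element, ← Multiset.singleton_add]
  abel

theorem stmt17Element_pow (i : Fin 6 × Fin 2 ⊕ Fin 4) : stmt17Element i ^ 105 = 1 := by
  have h3 : nu 3 ^ 105 = 1 := (nu_isPrimitiveRoot three_ne_zero).pow_eq_one_iff_dvd 105 |>.2
    (by norm_num)
  have h5 : nu 5 ^ 105 = 1 := (nu_isPrimitiveRoot (by norm_num)).pow_eq_one_iff_dvd 105 |>.2
    (by norm_num)
  have h7 : nu 7 ^ 105 = 1 := (nu_isPrimitiveRoot (by norm_num)).pow_eq_one_iff_dvd 105 |>.2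
    (by norm_num)
  rcases i with j | k
  · simp [stmt17Element, mul_pow, pow_right_comm _ _ 105, h3, h7]
  · simp [stmt17Element, mul_pow, pow_right_comm _ _ 105, h3, h5, h7]

theorem one_add_nu_three : 1 + nu 3 + nu 3 ^ 2 = 0 := by
  simpa [Finset.sum_range_succ] using
    (nu_isPrimitiveRoot three_ne_zero).geom_sum_eq_zero (by norm_num)

/-- The only relations with coefficients `0` and `1` between the elements of `stmt17Sorou` are the
trivial one and the one in which every coefficient is `1`. -/
theorem eq_of_stmt17_relation {a b c : ℕ → ℚ}
    (h : ∑ j ∈ Finset.range 6, (a j + b j * nu 3) * nu 7 ^ j +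
      nu 7 ^ 6 * nu 3 ^ 2 * ∑ k ∈ Finset.range 4, c k * nu 5 ^ (k + 1) = 0) :
    (∀ j < 6, a j = c 0 ∧ b j = c 0) ∧ ∀ k < 4, c k = c 0 := by
  have r3 : IsPrimitiveRoot (nu 3) 3 := nu_isPrimitiveRoot three_ne_zero
  have r5 : IsPrimitiveRoot (nu 5) 5 := nu_isPrimitiveRoot (by norm_num)
  have r7 : IsPrimitiveRoot (nu 7) 7 := nu_isPrimitiveRoot (by norm_num)
  have r15 : IsPrimitiveRoot (nu 15) 15 := nu_isPrimitiveRoot (by norm_num)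
  have e3 : nu 15 ^ 5 = nu 3 := by
    rw [nu, nu, ← Complex.exp_nat_mul]; congr 1; push_cast; ring
  have e5 : nu 15 ^ 3 = nu 5 := by
    rw [nu, nu, ← Complex.exp_nat_mul]; congr 1; push_cast; ring
  have hq (S : Subalgebra ℚ ℂ) (q : ℚ) : (q : ℂ) ∈ S := S.algebraMap_mem q
  have m15 : nu 15 ∈ Algebra.adjoin ℚ {nu 15} := Algebra.self_mem_adjoin_singleton ℚ _
  have m3 : nu 3 ∈ Algebra.adjoin ℚ {nu 15} := e3 ▸ pow_mem m15 5
  have m5 : nu 5 ∈ Algebra.adjoin ℚ {nu 15} := e5 ▸ pow_mem m15 3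
  have m33 : nu 3 ∈ Algebra.adjoin ℚ {nu 3} := Algebra.self_mem_adjoin_singleton ℚ _
  have c3 : nu 3 ^ 3 = 1 := r3.pow_eq_one
  have g3 := one_add_nu_three
  have hC (j : ℕ) (hj : j < 6) :
      a j + b j * nu 3 = nu 3 ^ 2 * ∑ k ∈ Finset.range 4, c k * nu 5 ^ (k + 1) := by
    have := r7.eq_of_sum_mul_pow_eq_zero (by norm_num) (by norm_num) (by norm_num) r15
      (x := fun j => if j < 6 then a j + b j * nu 3 else
        nu 3 ^ 2 * ∑ k ∈ Finset.range 4, c k * nu 5 ^ (k + 1)) (fun i _ => ?_) ?_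
      (i := j) (j := 6) (by omega) (by norm_num)
    · simpa [hj] using this
    · split_ifs
      · exact add_mem (hq _ _) (mul_mem (hq _ _) m3)
      · exact mul_mem (pow_mem m3 2) (sum_mem fun k _ => mul_mem (hq _ _) (pow_mem m5 _))
    · simp [Finset.sum_range_succ] at h ⊢
      linear_combination h
  have hc (j : ℕ) (hj : j < 6) (k : ℕ) (hk : k < 4) : (c k : ℂ) = -nu 3 * (a j + b j * nu 3) := by
    refine r5.eq_of_sum_mul_pow_eq_zero (by norm_num) (by norm_num) (by norm_num) r3
      (x := fun i => if i = 0 then -nu 3 * (a j + b j * nu 3) else (c (i - 1) : ℂ))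
      (fun i _ => ?_) ?_ (i := k + 1) (j := 0) (by omega) (by norm_num)
    · split_ifs
      · exact mul_mem (neg_mem m33) (add_mem (hq _ _) (mul_mem (hq _ _) m33))
      · exact hq _ _
    · rw [Finset.sum_range_succ', hC j hj]
      simp only [Nat.add_eq_zero_iff, one_ne_zero, and_false, if_false, if_true,
        Nat.add_sub_cancel, pow_zero, mul_one]
      linear_combination
        -(∑ k ∈ Finset.range 4, (c k : ℂ) * nu 5 ^ (k + 1)) * c3
  refine ⟨fun j hj => ?_, fun k hk => ?_⟩
  · have key (i : ℕ) (hi : i < 3) := r3.eq_of_sum_mul_pow_eq_zero (by norm_num) one_pos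
      (by norm_num) IsPrimitiveRoot.one
      (x := fun i => if i = 0 then ((a j - c 0 : ℚ) : ℂ) else
        if i = 1 then ((b j - c 0 : ℚ) : ℂ) else ((0 : ℚ) : ℂ))
      (fun i _ => by split_ifs <;> exact hq _ _) (by
        have := hc j hj 0 (by norm_num)
        simp only [Finset.sum_range_succ, Finset.sum_range_zero]
        push_cast
        simp
        linear_combination nu 3 ^ 2 * this - (c 0 : ℂ) * g3 - (a j + b j * nu 3) * c3)
      hi (j := 2) (by norm_num)
    have k0 := key 0 (by norm_num)
    have k1 := key 1 (by norm_num)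
    norm_num [sub_eq_zero] at k0 k1
    exact ⟨k0, k1⟩
  · exact_mod_cast (hc 0 (by norm_num) k hk).trans (hc 0 (by norm_num) 0 (by norm_num)).symm

theorem stmt17Sorou_sum : stmt17Sorou.sum = 0 := by
  have g3 := one_add_nu_three
  have g5 := (nu_isPrimitiveRoot (n := 5) (by norm_num)).geom_sum_eq_zero (by norm_num)
  have g7 := (nu_isPrimitiveRoot (n := 7) (by norm_num)).geom_sum_eq_zero (by norm_num)
  rw [stmt17Sorou_eq_map, ← Finset.sum_eq_multiset_sum]
  simp only [Fintype.sum_sum_type, Fintype.sum_prod_type, Fin.sum_univ_succ, stmt17Element]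
  simp [Finset.sum_range_succ] at g5 g7 ⊢
  linear_combination (1 + nu 3) * g7 + nu 7 ^ 6 * nu 3 ^ 2 * g5 - nu 7 ^ 6 * g3

theorem stmt17Sorou_minimal {g : Multiset ℂ} (hg : g ≤ stmt17Sorou) (hsum : g.sum = 0) :
    g = 0 ∨ g = stmt17Sorou := by
  classical
  rw [stmt17Sorou_eq_map] at hg ⊢
  obtain ⟨t, ht, rfl⟩ := Multiset.exists_le_of_le_map hg
  lift t to Finset (Fin 6 × Fin 2 ⊕ Fin 4) using Multiset.nodup_of_le ht Finset.univ.nodup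
  let v : Fin 6 × Fin 2 ⊕ Fin 4 → ℚ := fun i => if i ∈ t then 1 else 0
  have hv : ∑ i, (v i : ℂ) * stmt17Element i = 0 := by
    rw [← hsum, ← Finset.sum_eq_multiset_sum]
    simp only [v, apply_ite (Rat.cast : ℚ → ℂ), Rat.cast_one, Rat.cast_zero, ite_mul,
      one_mul, zero_mul, Finset.sum_ite_mem, Finset.univ_inter]
  have H := eq_of_stmt17_relation
    (a := fun j => if h : j < 6 then v (.inl (⟨j, h⟩, 0)) else 0)
    (b := fun j => if h : j < 6 then v (.inl (⟨j, h⟩, 1)) else 0)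
    (c := fun k => if h : k < 4 then v (.inr ⟨k, h⟩) else 0) (by
      rw [← hv, Fintype.sum_sum_type, Fintype.sum_prod_type, Finset.sum_range, Finset.sum_range,
        Finset.mul_sum]
      congr 1
      · refine Finset.sum_congr rfl fun j _ => ?_
        simp [stmt17Element]
        ring
      · refine Finset.sum_congr rfl fun k _ => ?_
        simp [stmt17Element]
        ring)
  have hconst (i : Fin 6 × Fin 2 ⊕ Fin 4) : v i = v (.inr 0) := by
    rcases i with ⟨j, l⟩ | k
    · have := H.1 j j.2
      fin_cases l
      · simpa using this.1
      · simpa using this.2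
    · simpa using H.2 k k.2
  by_cases h0 : Sum.inr 0 ∈ t
  · right
    have : t = Finset.univ := Finset.eq_univ_of_forall fun i => by
      by_contra hi
      simpa [v, hi, h0] using hconst i
    rw [this]
  · left
    have : t = ∅ := Finset.eq_empty_of_forall_notMem fun i hi => by
      simpa [v, hi, h0] using hconst i
    simp [this]

theorem stmt_17 :
    IsSorou stmt17Sorou ∧ IsMinVanishing stmt17Sorou ∧
    Multiset.card stmt17Sorou = 16 ∧
    ∀ z ∈ stmt17Sorou, Odd (rootOrder z) := by
  have hcard : Multiset.card stmt17Sorou = 16 := by simp [stmt17Sorou_eq_map]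
  have hpow : ∀ z ∈ stmt17Sorou, z ^ 105 = 1 := by
    intro z hz
    rw [stmt17Sorou_eq_map] at hz
    obtain ⟨i, -, rfl⟩ := Multiset.mem_map.1 hz
    exact stmt17Element_pow i
  have hroot : ∀ z ∈ stmt17Sorou, IsRootOfUnity z := fun z hz => ⟨105, by norm_num, hpow z hz⟩
  refine ⟨⟨fun h => by simp [h] at hcard, hroot⟩,
    ⟨stmt17Sorou_sum, fun g hg h0 h1 hsum => (stmt17Sorou_minimal hg hsum).elim h0 h1⟩,
    hcard, fun z hz => ?_⟩
  rw [rootOrder_eq_orderOf (hroot z hz)]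
  exact Odd.of_dvd_nat (by decide) (orderOf_dvd_of_pow_eq_one (hpow z hz))
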